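/- arXiv:1611.00926 — 2 statements merged into one kernel-verified Lean document; each statement's English description precedes it below -/
import Mathlib

section
/- Let p ∈ ℕ and let ω ∈ ℕ with ω ≥ 4^p. Let X be a metric space and suppose that for each i ∈ {1,…,2^p} we are given a family F_i = (U_i^1, …, U_i^ω) of ω nonempty bounded subsets of X, each of strictly positive diameter, such that for every i and every pair of distinct indices j ≠ j' one has dist(U_i^j, U_i^{j'}) ≥ 2·min{diam(U_i^j), diam(U_i^{j'})}. Then for each i ∈ {1,…,2^p} there is a subset I_i ⊆ {1,…,ω} with at least 2^p elements, such that whenever i ≠ i', j ∈ I_i and j' ∈ I_{i'}, one has dist(U_i^j, U_{i'}^{j'}) > 0. -/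
open Metric

/-- The distance between two subsets of a metric space:
`dist(U,V) = inf { d(u,v) : u ∈ U, v ∈ V }`. -/
noncomputable def setDist {X : Type*} [MetricSpace X] (U V : Set X) : ℝ :=
  sInf (Set.image2 dist U V)

theorem greedy_aux {ι β : Type*} [Fintype ι] [DecidableEq ι] [DecidableEq β]
    (C : ι → β → ι → β → Prop) (f : ι → β → ℝ)
    (hsymm : ∀ i j k a, C i j k a → C k a i j)
    (h : ∀ i j k a b, i ≠ k → a ≠ b → f i j ≤ f k a → f i j ≤ f k b →
      C i j k a → C i j k b → False) (m : ℕ) :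
    ∀ (n : ι → ℕ) (R : ι → Finset β), ∑ k, n k = m →
      (∀ k, 0 < n k → m ≤ (R k).card) →
      ∃ I : ι → Finset β, (∀ k, I k ⊆ R k) ∧ (∀ k, n k ≤ (I k).card) ∧
        ∀ i k, i ≠ k → ∀ j ∈ I i, ∀ a ∈ I k, ¬ C i j k a := by
  classical
  induction m with
  | zero =>
    intro n R hn _
    refine ⟨fun _ => ∅, by simp, fun k => ?_, by simp⟩
    have := (Finset.sum_eq_zero_iff.mp hn) k (Finset.mem_univ k)
    simp [this]
  | succ m ih =>
    intro n R hn hR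
    obtain ⟨i0, hi0⟩ : ∃ i, 0 < n i := by
      by_contra hcon
      push Not at hcon
      have : ∑ k, n k = 0 := Finset.sum_eq_zero fun k _ => by have := hcon k; omega
      omega
    have hj0 : (R i0).Nonempty := by
      rw [← Finset.card_pos]; have := hR i0 hi0; omega
    obtain ⟨j0, hj0⟩ := hj0
    let T : Finset (Σ _ : ι, β) := (Finset.univ.filter fun i => 0 < n i).sigma R
    have hT : T.Nonempty := ⟨⟨i0, j0⟩, by simp [T, hi0, hj0]⟩
    obtain ⟨⟨i, j⟩, hij, hmin⟩ := T.exists_min_image (fun x => f x.1 x.2) hT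
    simp only [T, Finset.mem_sigma, Finset.mem_filter, Finset.mem_univ, true_and] at hij hmin
    obtain ⟨hni, hjR⟩ := hij
    let n' : ι → ℕ := Function.update n i (n i - 1)
    let R' : ι → Finset β := fun k =>
      if k = i then (R k).erase j else (R k).filter fun a => ¬ C i j k a
    have hR'R : ∀ k, R' k ⊆ R k := by
      intro k
      by_cases hk : k = i
      · simp only [R', hk, if_true]; exact Finset.erase_subset _ _
      · simp only [R', hk, if_false]; exact Finset.filter_subset _ _
    have hs : ∑ k, n' k = m := by
      have h1 := Finset.sum_update_of_mem (Finset.mem_univ i) n (n i - 1)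
      have h2 := Finset.add_sum_erase Finset.univ n (Finset.mem_univ i)
      rw [Finset.sdiff_singleton_eq_erase] at h1
      simp only [n']
      omega
    have hc : ∀ k, 0 < n' k → m ≤ (R' k).card := by
      intro k hk
      by_cases hki : k = i
      · subst hki
        simp only [R', if_true]
        rw [Finset.card_erase_of_mem hjR]
        have := hR k hni
        omega
      · have hnk : 0 < n k := by simpa [n', hki] using hk
        simp only [R', hki, if_false]
        have h1 := hR k hnk
        have h2 := Finset.card_filter_add_card_filter_not (s := R k) (fun a => C i j k a)
        have h3 : ((R k).filter fun a => C i j k a).card ≤ 1 := by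
          rw [Finset.card_le_one]
          intro a ha b hb
          by_contra hab
          rw [Finset.mem_filter] at ha hb
          exact h i j k a b (Ne.symm hki) hab (hmin ⟨k, a⟩ ⟨hnk, ha.1⟩)
            (hmin ⟨k, b⟩ ⟨hnk, hb.1⟩) ha.2 hb.2
        omega
    obtain ⟨I, hI1, hI2, hI3⟩ := ih n' R' hs hc
    have key : ∀ k, k ≠ i → ∀ a ∈ I k, ¬ C i j k a := by
      intro k hk a ha
      have := hI1 k ha
      simp only [R', hk, if_false, Finset.mem_filter] at this
      exact this.2
    have hjI : j ∉ I i := by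
      intro hj
      have := hI1 i hj
      simp [R'] at this
    refine ⟨Function.update I i (insert j (I i)), ?_, ?_, ?_⟩
    · intro k
      by_cases hk : k = i
      · subst hk
        simp only [Function.update_self]
        exact Finset.insert_subset hjR ((hI1 k).trans (hR'R k))
      · simp only [Function.update_of_ne hk]
        exact (hI1 k).trans (hR'R k)
    · intro k
      have h2 := hI2 k
      by_cases hk : k = i
      · subst hk
        simp only [Function.update_self, n'] at h2 ⊢
        rw [Finset.card_insert_of_notMem hjI]
        omega
      · simpa [n', Function.update_of_ne hk] using h2
    · intro a b hab x hx y hy hC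
      by_cases ha : a = i
      · subst ha
        have hb : b ≠ a := Ne.symm hab
        rw [Function.update_self, Finset.mem_insert] at hx
        rw [Function.update_of_ne hb] at hy
        rcases hx with rfl | hx
        · exact key b hb y hy hC
        · exact hI3 a b hab x hx y hy hC
      · rw [Function.update_of_ne ha] at hx
        by_cases hb : b = i
        · subst hb
          rw [Function.update_self, Finset.mem_insert] at hy
          rcases hy with rfl | hy
          · exact key a ha x hx (hsymm _ _ _ _ hC)
          · exact hI3 a b hab x hx y hy hC
        · rw [Function.update_of_ne hb] at hy
          exact hI3 a b hab x hx y hy hC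

theorem setDist_symm_aux {X : Type*} [MetricSpace X] (U V : Set X) :
    setDist U V = setDist V U := by
  unfold setDist
  rw [Set.image2_swap]
  simp only [dist_comm]

theorem setDist_le_aux {X : Type*} [MetricSpace X] {U V : Set X} {u v : X}
    (hu : u ∈ U) (hv : v ∈ V) : setDist U V ≤ dist u v := by
  refine csInf_le ⟨0, ?_⟩ (Set.mem_image2_of_mem hu hv)
  rintro _ ⟨a, _, b, _, rfl⟩
  exact dist_nonneg

theorem setDist_lt_aux {X : Type*} [MetricSpace X] {U V : Set X} (hU : U.Nonempty)
    (hV : V.Nonempty) {e : ℝ} (h : setDist U V < e) : ∃ u ∈ U, ∃ v ∈ V, dist u v < e := by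
  obtain ⟨_, ⟨u, hu, v, hv, rfl⟩, hlt⟩ := exists_lt_of_csInf_lt (hU.image2 hV) h
  exact ⟨u, hu, v, hv, hlt⟩

theorem stmt0 {X : Type*} [MetricSpace X] (p ω : ℕ) (hω : 4 ^ p ≤ ω)
    (U : Fin (2 ^ p) → Fin ω → Set X)
    (hne : ∀ i j, (U i j).Nonempty)
    (hbd : ∀ i j, Bornology.IsBounded (U i j))
    (hdiam : ∀ i j, 0 < diam (U i j))
    (hsep : ∀ i, ∀ j j' : Fin ω, j ≠ j' →
      2 * min (diam (U i j)) (diam (U i j')) ≤ setDist (U i j) (U i j')) :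
    ∃ I : Fin (2 ^ p) → Finset (Fin ω),
      (∀ i, 2 ^ p ≤ (I i).card) ∧
      ∀ i i' : Fin (2 ^ p), i ≠ i' → ∀ j ∈ I i, ∀ j' ∈ I i',
        0 < setDist (U i j) (U i' j') := by
  obtain ⟨I, -, h2, h3⟩ := greedy_aux
    (fun i j k a => ¬ 0 < setDist (U i j) (U k a)) (fun i j => diam (U i j))
    (fun i j k a hC => by rwa [setDist_symm_aux]) (by
      intro i j k a b _ hab ha hb hCa hCb
      have hd := hdiam i j
      obtain ⟨u, hu, v, hv, huv⟩ := setDist_lt_aux (hne i j) (hne k a)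
        (e := diam (U i j) / 2) (by linarith)
      obtain ⟨u', hu', v', hv', huv'⟩ := setDist_lt_aux (hne i j) (hne k b)
        (e := diam (U i j) / 2) (by linarith)
      have h1 := hsep k a b hab
      have h2 := setDist_le_aux hv hv'
      have h3 := dist_le_diam_of_mem (hbd i j) hu hu'
      have h4 := dist_triangle4 v u u' v'
      rw [dist_comm v u] at h4
      have h5 := le_min ha hb
      linarith)
    (4 ^ p) (fun _ => 2 ^ p) (fun _ => Finset.univ)
    (by
      rw [Finset.sum_const, Finset.card_univ, Fintype.card_fin, smul_eq_mul, ← mul_pow]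
      norm_num)
    (by intro k _; simpa using hω)
  exact ⟨I, h2, fun i i' hi j hj j' hj' => not_not.mp (h3 i i' hi j hj j' hj')⟩
end

section
/- Let n ≥ 1 and let S be an n-dimensional varifold in ℝ^{n+1}, i.e. a measure on ℝ^{n+1} × Proj_n that is finite on compact sets, whose support is contained in {x ∈ ℝ^{n+1} : x_1 ≤ 0} × Proj_n. Assume that δS(χ) = 0 for every smooth compactly supported vector field χ : ℝ^{n+1} → ℝ^{n+1} that is tangent to the hyperplane {x_1 = 0}, and that there exist radii 0 < ρ < r with ρ^{−n}·‖S‖(B_ρ(0)) = r^{−n}·‖S‖(B_r(0)). Then s^{−n}·‖S‖(B_s(0)) = ρ^{−n}·‖S‖(B_ρ(0)) for every s ∈ [ρ, r]. -/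
open MeasureTheory Metric

noncomputable section

/-- Euclidean space `ℝ^{n+1}`. -/
abbrev Euc (n : ℕ) : Type := EuclideanSpace ℝ (Fin (n + 1))

/-- The space `Proj_n` of orthogonal projections of `ℝ^{n+1}` onto `n`-dimensional
linear subspaces, encoded as continuous linear maps which are self-adjoint,
idempotent and have trace `n`. -/
abbrev ProjN (n : ℕ) : Type :=
  { P : Euc n →L[ℝ] Euc n //
      IsSelfAdjoint P ∧ P.comp P = P ∧
        LinearMap.trace ℝ (Euc n) (P : Euc n →ₗ[ℝ] Euc n) = (n : ℝ) }

instance (n : ℕ) : MeasurableSpace (ProjN n) := borel _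

/-- The tangential divergence `div_P χ (x) = trace (P ∘ Dχ(x))` of a vector field
`χ : ℝ^{n+1} → ℝ^{n+1}` with respect to the projection `P`. -/
def tangentialDiv (n : ℕ) (P : ProjN n) (χ : Euc n → Euc n) (x : Euc n) : ℝ :=
  LinearMap.trace ℝ (Euc n)
    (((P : Euc n →L[ℝ] Euc n).comp (fderiv ℝ χ x) : Euc n →L[ℝ] Euc n) :
      Euc n →ₗ[ℝ] Euc n)

/-- The first variation `δS(χ) = ∫ div_P χ(x) dS(x,P)` of a varifold `S`. -/
def firstVariation (n : ℕ) (S : Measure (Euc n × ProjN n)) (χ : Euc n → Euc n) : ℝ :=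
  ∫ q : Euc n × ProjN n, tangentialDiv n q.2 χ q.1 ∂S

/-- The weight `‖S‖` of a varifold `S`, i.e. the pushforward of `S` under
`(x, P) ↦ x`. -/
def weight (n : ℕ) (S : Measure (Euc n × ProjN n)) : Measure (Euc n) :=
  S.map Prod.fst

instance projN_borelSpace (n : ℕ) : BorelSpace (ProjN n) := ⟨rfl⟩

lemma projN_inner_eq (n : ℕ) (P : ProjN n) (x : Euc n) :
    inner ℝ x (P.1 x) = ‖P.1 x‖ ^ 2 := by
  obtain ⟨P, h1, h2, h3⟩ := P
  have hs := ContinuousLinearMap.isSelfAdjoint_iff_isSymmetric.1 h1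
  have h4 : P (P x) = P x := by
    have := congrArg (fun L : Euc n →L[ℝ] Euc n => L x) h2
    simpa using this
  have h5 := hs x (P x)
  simp only [ContinuousLinearMap.coe_coe] at h5
  rw [h4] at h5
  show inner ℝ x (P x) = ‖P x‖ ^ 2
  rw [← h5, real_inner_self_eq_norm_sq]

lemma projN_norm_apply_le (n : ℕ) (P : ProjN n) (x : Euc n) : ‖P.1 x‖ ≤ ‖x‖ := by
  have h := projN_inner_eq n P x
  have h2 := real_inner_le_norm x (P.1 x)
  rw [h] at h2
  by_contra! hlt
  have := norm_nonneg x
  nlinarith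

lemma projN_inner_le (n : ℕ) (P : ProjN n) (x : Euc n) :
    inner ℝ x (P.1 x) ≤ ‖x‖ ^ 2 := by
  rw [projN_inner_eq]
  have := projN_norm_apply_le n P x
  have := norm_nonneg (P.1 x)
  gcongr

instance projN_compactSpace (n : ℕ) : CompactSpace (ProjN n) := by
  apply isCompact_iff_compactSpace.1
  apply Metric.isCompact_of_isClosed_isBounded
  · have e1 : IsClosed {P : Euc n →L[ℝ] Euc n | IsSelfAdjoint P} :=
      isClosed_eq (ContinuousLinearMap.adjoint (𝕜 := ℝ) (E := Euc n) (F := Euc n)).continuous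
        continuous_id
    have e2 : IsClosed {P : Euc n →L[ℝ] Euc n | P.comp P = P} :=
      isClosed_eq (continuous_id.clm_comp continuous_id) continuous_id
    have e3 : IsClosed {P : Euc n →L[ℝ] Euc n |
        LinearMap.trace ℝ (Euc n) (P : Euc n →ₗ[ℝ] Euc n) = (n : ℝ)} := by
      refine isClosed_eq ?_ continuous_const
      exact LinearMap.continuous_of_finiteDimensional
        ((LinearMap.trace ℝ (Euc n)).comp (ContinuousLinearMap.coeLM ℝ))
    exact e1.inter (e2.inter e3)
  · refine (Metric.isBounded_closedBall (x := (0 : Euc n →L[ℝ] Euc n)) (r := 1)).subset ?_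
    intro P hP
    rw [mem_closedBall_zero_iff]
    refine ContinuousLinearMap.opNorm_le_bound _ zero_le_one fun x => ?_
    rw [one_mul]
    exact projN_norm_apply_le n ⟨P, hP⟩ x

lemma compact_cyl (n : ℕ) (R : ℝ) :
    IsCompact {q : Euc n × ProjN n | ‖q.1‖ ≤ R} := by
  have : {q : Euc n × ProjN n | ‖q.1‖ ≤ R} = closedBall (0 : Euc n) R ×ˢ Set.univ := by
    ext q; simp
  rw [this]
  exact (isCompact_closedBall _ _).prod isCompact_univ

lemma integrable_cyl (n : ℕ) (S : Measure (Euc n × ProjN n)) [IsFiniteMeasureOnCompacts S]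
    (R : ℝ) (f : Euc n × ProjN n → ℝ) (hf : Continuous f)
    (h0 : ∀ q : Euc n × ProjN n, R < ‖q.1‖ → f q = 0) : Integrable f S := by
  apply hf.integrable_of_hasCompactSupport
  apply HasCompactSupport.intro (compact_cyl n R)
  intro q hq
  exact h0 q (by simpa using hq)

lemma integrable_indic (n : ℕ) (S : Measure (Euc n × ProjN n)) [IsFiniteMeasureOnCompacts S]
    (R C : ℝ) :
    Integrable (Set.indicator {q : Euc n × ProjN n | ‖q.1‖ ≤ R} fun _ => C) S := by
  rw [integrable_indicator_iff (compact_cyl n R).measurableSet]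
  exact integrableOn_const (compact_cyl n R).measure_lt_top.ne

/-- Formula for the tangential divergence of a radial field. -/
lemma tangentialDiv_radial (n : ℕ) (P : ProjN n) (ψ : ℝ → ℝ) (hψ : ContDiff ℝ (⊤ : ℕ∞) ψ)
    (c : ℝ) (x : Euc n) :
    tangentialDiv n P (fun x => ψ (c * ‖x‖ ^ 2) • x) x
      = n * ψ (c * ‖x‖ ^ 2) + deriv ψ (c * ‖x‖ ^ 2) * (2 * c * inner ℝ x (P.1 x)) := by
  have h1 : HasFDerivAt (fun x : Euc n => c * ‖x‖ ^ 2) (c • (2 • innerSL ℝ x)) x :=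
    (hasStrictFDerivAt_norm_sq x).hasFDerivAt.const_mul c
  have hd : HasDerivAt ψ (deriv ψ (c * ‖x‖ ^ 2)) (c * ‖x‖ ^ 2) :=
    (hψ.differentiable (by simp)).differentiableAt.hasDerivAt
  have h2 := hd.comp_hasFDerivAt x h1
  have h3 := h2.smul (hasFDerivAt_id x)
  have h4 : fderiv ℝ (fun x : Euc n => ψ (c * ‖x‖ ^ 2) • x) x = _ := h3.fderiv
  unfold tangentialDiv
  rw [h4]
  have h5 : (((P : Euc n →L[ℝ] Euc n).comp (ψ (c * ‖x‖ ^ 2) • ContinuousLinearMap.id ℝ (Euc n)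
      + ContinuousLinearMap.smulRight (deriv ψ (c * ‖x‖ ^ 2) • (c • (2 • innerSL ℝ x))) x) :
      Euc n →L[ℝ] Euc n) : Euc n →ₗ[ℝ] Euc n)
      = ψ (c * ‖x‖ ^ 2) • ((P : Euc n →L[ℝ] Euc n) : Euc n →ₗ[ℝ] Euc n)
       + LinearMap.smulRight ((deriv ψ (c * ‖x‖ ^ 2) • (c • (2 • innerSL ℝ x)) :
          Euc n →L[ℝ] ℝ) : Euc n →ₗ[ℝ] ℝ) (P.1 x) := by
    ext v : 1
    simp
  refine (congrArg (LinearMap.trace ℝ (Euc n)) h5).trans ?_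
  rw [map_add, map_smul, LinearMap.trace_smulRight, P.2.2.2]
  simp
  ring

lemma deriv_zero_of_one_lt (ψ : ℝ → ℝ) (h0 : ∀ t, 1 ≤ t → ψ t = 0) (t : ℝ) (ht : 1 < t) :
    deriv ψ t = 0 := by
  have : ψ =ᶠ[nhds t] fun _ => 0 := by
    filter_upwards [lt_mem_nhds ht] with u hu using h0 u hu.le
  rw [this.deriv_eq]; simp

lemma one_lt_scaled {σ N R : ℝ} (hσ : 0 < σ) (hR : σ ≤ R) (h : R < N) :
    1 < (σ ^ 2)⁻¹ * N ^ 2 := by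
  rw [inv_mul_eq_div, one_lt_div (by positivity)]
  gcongr
  linarith

lemma stationarity_ineq (n : ℕ) (S : Measure (Euc n × ProjN n)) [IsFiniteMeasureOnCompacts S]
    (hstat : ∀ χ : Euc n → Euc n, ContDiff ℝ (⊤ : ℕ∞) χ → HasCompactSupport χ →
      (∀ x : Euc n, x 0 = 0 → χ x 0 = 0) → firstVariation n S χ = 0)
    (ψ : ℝ → ℝ) (hψ : ContDiff ℝ (⊤ : ℕ∞) ψ) (hanti : Antitone ψ)
    (h0 : ∀ t, 1 ≤ t → ψ t = 0) (σ : ℝ) (hσ : 0 < σ) :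
    ∫ q, (n * ψ ((σ ^ 2)⁻¹ * ‖q.1‖ ^ 2) +
      deriv ψ ((σ ^ 2)⁻¹ * ‖q.1‖ ^ 2) * (2 * (σ ^ 2)⁻¹ * ‖q.1‖ ^ 2)) ∂S ≤ 0 := by
  have hc : 0 ≤ (σ ^ 2)⁻¹ := by positivity
  have hdc : Continuous (deriv ψ) := hψ.continuous_deriv (by simp)
  have hψc : Continuous ψ := hψ.continuous
  have hz := deriv_zero_of_one_lt ψ h0
  rw [← hstat (fun x => ψ ((σ ^ 2)⁻¹ * ‖x‖ ^ 2) • x) ?_ ?_ ?_]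
  · unfold firstVariation
    simp only [tangentialDiv_radial n _ ψ hψ]
    apply integral_mono
    · apply integrable_cyl n S σ
      · fun_prop
      · intro q hq
        have := one_lt_scaled hσ le_rfl hq
        simp only [h0 _ this.le, hz _ this]; simp
    · apply integrable_cyl n S σ
      · have : Continuous fun q : Euc n × ProjN n => q.2.1 q.1 :=
          (continuous_subtype_val.comp continuous_snd).clm_apply continuous_fst
        fun_prop
      · intro q hq
        have := one_lt_scaled hσ le_rfl hq
        simp only [h0 _ this.le, hz _ this]; simp
    · intro q
      have h1 := projN_inner_le n q.2 q.1
      have h2 : deriv ψ ((σ ^ 2)⁻¹ * ‖q.1‖ ^ 2) ≤ 0 := hanti.deriv_nonpos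
      have h3 : 2 * (σ ^ 2)⁻¹ * inner ℝ q.1 (q.2.1 q.1) ≤ 2 * (σ ^ 2)⁻¹ * ‖q.1‖ ^ 2 := by gcongr
      have := mul_le_mul_of_nonpos_left h3 h2
      simp only
      linarith
  · exact (hψ.comp (contDiff_const.mul (contDiff_norm_sq ℝ))).smul contDiff_id
  · apply HasCompactSupport.intro (isCompact_closedBall (0 : Euc n) σ)
    intro x hx
    rw [mem_closedBall_zero_iff, not_le] at hx
    rw [h0 _ (one_lt_scaled hσ le_rfl hx).le, zero_smul]
  · intro x hx
    simp [hx]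

lemma hasDerivAt_J (n : ℕ) (S : Measure (Euc n × ProjN n)) [IsFiniteMeasureOnCompacts S]
    (ψ : ℝ → ℝ) (hψ : ContDiff ℝ (⊤ : ℕ∞) ψ)
    (h0 : ∀ t, 1 ≤ t → ψ t = 0) (σ : ℝ) (hσ : 0 < σ) :
    Integrable (fun q : Euc n × ProjN n =>
      deriv ψ ((σ ^ 2)⁻¹ * ‖q.1‖ ^ 2) * ((σ ^ 2)⁻¹ * ‖q.1‖ ^ 2) * (-2 / σ)) S ∧
    HasDerivAt (fun σ : ℝ => ∫ q, ψ ((σ ^ 2)⁻¹ * ‖q.1‖ ^ 2) ∂S)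
      (∫ q, deriv ψ ((σ ^ 2)⁻¹ * ‖q.1‖ ^ 2) * ((σ ^ 2)⁻¹ * ‖q.1‖ ^ 2) * (-2 / σ) ∂S) σ := by
  have hdc : Continuous (deriv ψ) := hψ.continuous_deriv (by simp)
  have hψc : Continuous ψ := hψ.continuous
  have hz := deriv_zero_of_one_lt ψ h0
  obtain ⟨C, hC⟩ := (isCompact_Icc (a := (0:ℝ)) (b := 1)).exists_bound_of_continuousOn
    (f := fun t => deriv ψ t * t) (by fun_prop)
  have hC0 : 0 ≤ C := (norm_nonneg _).trans (hC 0 (by simp))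
  refine hasDerivAt_integral_of_dominated_loc_of_deriv_le (s := Set.Ioo (σ / 2) (2 * σ))
    (F := fun (σ : ℝ) (q : Euc n × ProjN n) => ψ ((σ ^ 2)⁻¹ * ‖q.1‖ ^ 2))
    (F' := fun (σ : ℝ) (q : Euc n × ProjN n) =>
      deriv ψ ((σ ^ 2)⁻¹ * ‖q.1‖ ^ 2) * ((σ ^ 2)⁻¹ * ‖q.1‖ ^ 2) * (-2 / σ))
    (bound := Set.indicator {q : Euc n × ProjN n | ‖q.1‖ ≤ 2 * σ} fun _ => C * (4 / σ))
    ?_ ?_ ?_ ?_ ?_ ?_ ?_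
  · exact Ioo_mem_nhds (by linarith) (by linarith)
  · refine Filter.Eventually.of_forall fun s => ?_
    exact Continuous.aestronglyMeasurable (by fun_prop)
  · apply integrable_cyl n S σ
    · fun_prop
    · intro q hq
      exact h0 _ (one_lt_scaled hσ le_rfl hq).le
  · exact Continuous.aestronglyMeasurable (by fun_prop)
  · refine Filter.Eventually.of_forall fun q s hs => ?_
    have hs0 : 0 < s := by linarith [hs.1]
    by_cases hq : ‖q.1‖ ≤ 2 * σ
    · rw [Set.indicator_of_mem (by exact hq), norm_mul]
      have e1 : ‖deriv ψ ((s ^ 2)⁻¹ * ‖q.1‖ ^ 2) * ((s ^ 2)⁻¹ * ‖q.1‖ ^ 2)‖ ≤ C := by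
        by_cases ht : (s ^ 2)⁻¹ * ‖q.1‖ ^ 2 ≤ 1
        · exact hC _ ⟨by positivity, ht⟩
        · rw [hz _ (not_le.1 ht)]; simpa using hC0
      have e2 : ‖-2 / s‖ ≤ 4 / σ := by
        rw [norm_div, Real.norm_of_nonneg hs0.le, norm_neg, Real.norm_of_nonneg (by norm_num),
          div_le_div_iff₀ hs0 hσ]
        linarith [hs.1]
      gcongr
    · rw [Set.indicator_of_notMem (by exact hq)]
      rw [hz _ (one_lt_scaled hs0 hs.2.le (not_le.1 hq))]
      simp
  · exact integrable_indic n S _ _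
  · refine Filter.Eventually.of_forall fun q s hs => ?_
    have hs0 : 0 < s := by linarith [hs.1]
    have hd : HasDerivAt ψ (deriv ψ ((s ^ 2)⁻¹ * ‖q.1‖ ^ 2)) ((s ^ 2)⁻¹ * ‖q.1‖ ^ 2) :=
      (hψ.differentiable (by simp)).differentiableAt.hasDerivAt
    have h1 : HasDerivAt (fun s : ℝ => (s ^ 2)⁻¹ * ‖q.1‖ ^ 2)
        (((s ^ 2)⁻¹ * ‖q.1‖ ^ 2) * (-2 / s)) s := by
      have := (((hasDerivAt_id s).pow 2).inv (by simp [hs0.ne'])).mul_const (‖q.1‖ ^ 2)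
      refine this.congr_deriv ?_
      simp
      field_simp
    refine (hd.comp s h1).congr_deriv ?_
    ring

lemma mono_smooth (n : ℕ) (S : Measure (Euc n × ProjN n)) [IsFiniteMeasureOnCompacts S]
    (hstat : ∀ χ : Euc n → Euc n, ContDiff ℝ (⊤ : ℕ∞) χ → HasCompactSupport χ →
      (∀ x : Euc n, x 0 = 0 → χ x 0 = 0) → firstVariation n S χ = 0)
    (ψ : ℝ → ℝ) (hψ : ContDiff ℝ (⊤ : ℕ∞) ψ) (hanti : Antitone ψ)
    (h0 : ∀ t, 1 ≤ t → ψ t = 0) :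
    MonotoneOn (fun σ : ℝ => (∫ q, ψ ((σ ^ 2)⁻¹ * ‖q.1‖ ^ 2) ∂S) / σ ^ n) (Set.Ioi 0) := by
  have key : ∀ σ : ℝ, 0 < σ → ∃ d, 0 ≤ d ∧
      HasDerivAt (fun σ : ℝ => (∫ q, ψ ((σ ^ 2)⁻¹ * ‖q.1‖ ^ 2) ∂S) / σ ^ n) d σ := by
    intro σ hσ
    obtain ⟨hi, hd⟩ := hasDerivAt_J n S ψ hψ h0 σ hσ
    have hs := stationarity_ineq n S hstat ψ hψ hanti h0 σ hσ
    have hψc : Continuous ψ := hψ.continuous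
    have hi0 : Integrable (fun q : Euc n × ProjN n => ψ ((σ ^ 2)⁻¹ * ‖q.1‖ ^ 2)) S := by
      apply integrable_cyl n S σ
      · fun_prop
      · intro q hq
        exact h0 _ (one_lt_scaled hσ le_rfl hq).le
    have e : ∀ q : Euc n × ProjN n, (n * ψ ((σ ^ 2)⁻¹ * ‖q.1‖ ^ 2) +
      deriv ψ ((σ ^ 2)⁻¹ * ‖q.1‖ ^ 2) * (2 * (σ ^ 2)⁻¹ * ‖q.1‖ ^ 2))
      = n * ψ ((σ ^ 2)⁻¹ * ‖q.1‖ ^ 2) + (-σ) *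
      (deriv ψ ((σ ^ 2)⁻¹ * ‖q.1‖ ^ 2) * ((σ ^ 2)⁻¹ * ‖q.1‖ ^ 2) * (-2 / σ)) := by
      intro q
      field_simp
    simp only [e] at hs
    rw [integral_add (hi0.const_mul _) (hi.const_mul _), integral_const_mul,
      integral_const_mul] at hs
    have hp : HasDerivAt (fun σ : ℝ => σ ^ n) (n * σ ^ (n - 1)) σ := hasDerivAt_pow n σ
    refine ⟨_, ?_, hd.div hp (by positivity)⟩
    apply div_nonneg _ (by positivity)
    rcases Nat.eq_zero_or_pos n with rfl | hn
    · simp at hs ⊢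
      nlinarith
    · have hpow : σ ^ n = σ ^ (n - 1) * σ := by rw [← pow_succ, Nat.sub_add_cancel hn]
      rw [hpow]
      have hp0 : 0 ≤ σ ^ (n - 1) := by positivity
      nlinarith [mul_nonneg hp0 (neg_nonneg.2 hs)]
  choose! d hd0 hd using key
  apply monotoneOn_of_deriv_nonneg (convex_Ioi 0)
  · intro σ hσ
    exact (hd σ hσ).continuousAt.continuousWithinAt
  · rw [interior_Ioi]
    intro σ hσ
    exact (hd σ hσ).differentiableAt.differentiableWithinAt
  · rw [interior_Ioi]
    intro σ hσ
    rw [(hd σ hσ).deriv]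
    exact hd0 σ hσ

/-- The smooth cutoff functions increasing to the indicator of `(-∞, 1)`. -/
def cutoff (k : ℕ) (t : ℝ) : ℝ := Real.smoothTransition (k * (1 - t))

lemma cutoff_tendsto (n : ℕ) (S : Measure (Euc n × ProjN n)) [IsFiniteMeasureOnCompacts S]
    (σ : ℝ) (hσ : 0 < σ) :
    Filter.Tendsto (fun k : ℕ => ∫ q, cutoff k ((σ ^ 2)⁻¹ * ‖q.1‖ ^ 2) ∂S) Filter.atTop
      (nhds (weight n S (ball (0 : Euc n) σ)).toReal) := by
  have hm : MeasurableSet {q : Euc n × ProjN n | ‖q.1‖ < σ} :=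
    (isOpen_lt (by fun_prop) continuous_const).measurableSet
  have hw : (weight n S (ball (0 : Euc n) σ)).toReal
      = ∫ q, Set.indicator {q : Euc n × ProjN n | ‖q.1‖ < σ} (fun _ => (1:ℝ)) q ∂S := by
    rw [integral_indicator_const _ hm]
    unfold weight
    rw [Measure.map_apply measurable_fst measurableSet_ball]
    have : (Prod.fst ⁻¹' ball (0 : Euc n) σ : Set (Euc n × ProjN n)) = {q | ‖q.1‖ < σ} := by
      ext q; simp
    rw [this]
    simp [Measure.real]
  rw [hw]
  apply tendsto_integral_of_dominated_convergence
    (Set.indicator {q : Euc n × ProjN n | ‖q.1‖ ≤ σ} fun _ => (1:ℝ))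
  · intro k
    have := Real.smoothTransition.continuous
    unfold cutoff
    exact Continuous.aestronglyMeasurable (by fun_prop)
  · exact integrable_indic n S _ _
  · intro k
    refine Filter.Eventually.of_forall fun q => ?_
    unfold cutoff
    rw [Real.norm_of_nonneg (Real.smoothTransition.nonneg _)]
    by_cases hq : ‖q.1‖ ≤ σ
    · rw [Set.indicator_of_mem (by exact hq)]
      exact Real.smoothTransition.le_one _
    · rw [Set.indicator_of_notMem (by exact hq)]
      have := one_lt_scaled hσ le_rfl (not_le.1 hq)
      rw [Real.smoothTransition.zero_of_nonpos]
      exact mul_nonpos_of_nonneg_of_nonpos (by positivity) (by linarith)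
  · refine Filter.Eventually.of_forall fun q => ?_
    unfold cutoff
    by_cases hq : ‖q.1‖ < σ
    · rw [Set.indicator_of_mem (by exact hq)]
      have ht : (σ ^ 2)⁻¹ * ‖q.1‖ ^ 2 < 1 := by
        rw [inv_mul_eq_div, div_lt_one (by positivity)]
        gcongr
      have h1 : Filter.Tendsto (fun k : ℕ => (k : ℝ) * (1 - (σ ^ 2)⁻¹ * ‖q.1‖ ^ 2))
          Filter.atTop Filter.atTop :=
        tendsto_natCast_atTop_atTop.atTop_mul_const (by linarith)
      apply tendsto_const_nhds.congr'
      filter_upwards [h1.eventually_ge_atTop 1] with k hk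
      exact (Real.smoothTransition.one_of_one_le hk).symm
    · rw [Set.indicator_of_notMem (by exact hq)]
      apply tendsto_const_nhds.congr
      intro k
      rw [Real.smoothTransition.zero_of_nonpos]
      have : 1 ≤ (σ ^ 2)⁻¹ * ‖q.1‖ ^ 2 := by
        rw [inv_mul_eq_div, one_le_div (by positivity)]
        have := not_lt.1 hq
        gcongr
      exact mul_nonpos_of_nonneg_of_nonpos (by positivity) (by linarith)

lemma monotonicity (n : ℕ) (S : Measure (Euc n × ProjN n)) [IsFiniteMeasureOnCompacts S]
    (hstat : ∀ χ : Euc n → Euc n, ContDiff ℝ (⊤ : ℕ∞) χ → HasCompactSupport χ →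
      (∀ x : Euc n, x 0 = 0 → χ x 0 = 0) → firstVariation n S χ = 0)
    (a b : ℝ) (ha : 0 < a) (hab : a ≤ b) :
    (weight n S (ball (0 : Euc n) a)).toReal / a ^ n
      ≤ (weight n S (ball (0 : Euc n) b)).toReal / b ^ n := by
  have hb : 0 < b := ha.trans_le hab
  refine le_of_tendsto_of_tendsto ((cutoff_tendsto n S a ha).div_const _)
    ((cutoff_tendsto n S b hb).div_const _) (Filter.Eventually.of_forall fun k => ?_)
  refine mono_smooth n S hstat (cutoff k) ?_ ?_ ?_ ha hb hab
  · exact Real.smoothTransition.contDiff.comp (by fun_prop)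
  · intro s t hst
    unfold cutoff
    apply Real.smoothTransition.monotone
    gcongr
  · intro t ht
    exact Real.smoothTransition.zero_of_nonpos
      (mul_nonpos_of_nonneg_of_nonpos (by positivity) (by linarith))

theorem stmt4 (n : ℕ) (hn : 1 ≤ n) (S : Measure (Euc n × ProjN n))
    [IsFiniteMeasureOnCompacts S]
    -- the support of `S` is contained in `{x : x₁ ≤ 0} × Proj_n`, i.e. the open
    -- complement `{x : x₁ > 0} × Proj_n` is a null set:
    (hsupp : S {q : Euc n × ProjN n | 0 < q.1 0} = 0)
    -- `δS(χ) = 0` for every smooth compactly supported vector field `χ`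
    -- tangent to the hyperplane `{x₁ = 0}`:
    (hstat : ∀ χ : Euc n → Euc n, ContDiff ℝ (⊤ : ℕ∞) χ → HasCompactSupport χ →
      (∀ x : Euc n, x 0 = 0 → χ x 0 = 0) → firstVariation n S χ = 0)
    (ρ r : ℝ) (hρ : 0 < ρ) (hρr : ρ < r)
    (heq : (weight n S (ball (0 : Euc n) ρ)).toReal / ρ ^ n
         = (weight n S (ball (0 : Euc n) r)).toReal / r ^ n) :
    ∀ s ∈ Set.Icc ρ r,
      (weight n S (ball (0 : Euc n) s)).toReal / s ^ n
        = (weight n S (ball (0 : Euc n) ρ)).toReal / ρ ^ n := by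
  intro s hs
  apply le_antisymm
  · rw [heq]
    exact monotonicity n S hstat s r (hρ.trans_le hs.1) hs.2
  · exact monotonicity n S hstat ρ s hρ hs.1

end
end
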